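/- Let n and t be fixed integers with 1 ≤ t ≤ n, and let p : ℕ → (0,1). Let 𝔍 = 𝔍(D) be the random monomial ideal of the ER-type model with parameter p(D). Then D^{-t} is a threshold function for the property dim S/𝔍 ≤ t−1: if D^t · p(D) → 0 as D → ∞, then P(dim S/𝔍 ≤ t−1) → 0; and if D^t · p(D) → ∞ as D → ∞, then P(dim S/𝔍 ≤ t−1) → 1. -/

import Mathlib

open Finset MvPolynomial Filter

noncomputable section

/-- The set of exponent vectors of nonconstant monomials in `n` variables of total degree
at most `D`. -/
def monSet (n D : ℕ) : Finset (Fin n → ℕ) :=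
  (Fintype.piFinset fun _ : Fin n => Finset.range (D + 1)).filter
    fun α => 0 < ∑ i, α i ∧ ∑ i, α i ≤ D

/-- The monomial `x^α` of `MvPolynomial (Fin n) K` with exponent vector `α`. -/
def mono (K : Type*) [CommRing K] {n : ℕ} (α : Fin n → ℕ) : MvPolynomial (Fin n) K :=
  MvPolynomial.monomial (Finsupp.equivFunOnFinite.symm α) 1

/-- The monomial ideal generated by a set of exponent vectors. -/
def idealOf (K : Type*) [CommRing K] {n : ℕ} (B : Finset (Fin n → ℕ)) :
    Ideal (MvPolynomial (Fin n) K) :=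
  Ideal.span (mono K '' (B : Set (Fin n → ℕ)))

open Classical in
/-- The probability, under the ER-type model `ℐ(n,D,p)`, of the event `E` on random
generating sets `𝔅 ⊆ M(n,D)`. -/
def ERprob (n D : ℕ) (p : ℝ) (E : Set (Finset (Fin n → ℕ))) : ℝ :=
  ∑ B ∈ (monSet n D).powerset.filter (· ∈ E),
    p ^ B.card * (1 - p) ^ ((monSet n D).card - B.card)

/-- `I` is a monomial ideal. -/
def IsMonomialIdeal (K : Type*) [CommRing K] {n : ℕ}
    (I : Ideal (MvPolynomial (Fin n) K)) : Prop :=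
  ∃ G : Set (Fin n → ℕ), I = Ideal.span (mono K '' G)

/-- `x^α` is a minimal monomial generator of `I`: it lies in `I` and no proper divisor does. -/
def IsMinGen (K : Type*) [CommRing K] {n : ℕ} (I : Ideal (MvPolynomial (Fin n) K))
    (α : Fin n → ℕ) : Prop :=
  mono K α ∈ I ∧ ∀ β : Fin n → ℕ, (∀ i, β i ≤ α i) → β ≠ α → mono K β ∉ I

/-- `β₁(S/I)`: the number of minimal monomial generators of `I`. -/
def beta1 (K : Type*) [CommRing K] {n : ℕ} (I : Ideal (MvPolynomial (Fin n) K)) : ℕ :=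
  {α : Fin n → ℕ | IsMinGen K I α}.ncard

/-- `β_{1,d}(S/I)`: the number of minimal monomial generators of `I` of degree `d`. -/
def beta1d (K : Type*) [CommRing K] {n : ℕ} (I : Ideal (MvPolynomial (Fin n) K)) (d : ℕ) : ℕ :=
  {α : Fin n → ℕ | IsMinGen K I α ∧ ∑ i, α i = d}.ncard

/-- `h_I(d)`: the number of monomials of degree exactly `d` not contained in `I`. -/
def hilb (K : Type*) [CommRing K] {n : ℕ} (I : Ideal (MvPolynomial (Fin n) K)) (d : ℕ) : ℕ :=
  {α : Fin n → ℕ | ∑ i, α i = d ∧ mono K α ∉ I}.ncard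

lemma ringKrullDim_quotient_le_of_forall_prime {R : Type*} [CommRing R] (I : Ideal R)
    (m : WithBot ℕ∞)
    (h : ∀ P : Ideal R, P.IsPrime → I ≤ P → ringKrullDim (R ⧸ P) ≤ m) :
    ringKrullDim (R ⧸ I) ≤ m := by
  rw [ringKrullDim_quotient, Order.krullDim_eq_iSup_coheight]
  refine iSup_le fun a => ?_
  rw [Order.coheight_eq_krullDim_Ici]
  refine le_trans ?_ (h a.1.asIdeal a.1.2 a.2)
  rw [ringKrullDim_quotient]
  exact Order.krullDim_le_of_strictMono
    (fun x : Set.Ici a => (⟨x.1.1, x.2⟩ : PrimeSpectrum.zeroLocus (a.1.asIdeal : Set R)))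
    fun _ _ hxy => hxy

lemma mono_eq_prod (K : Type*) [CommRing K] {n : ℕ} (α : Fin n → ℕ) :
    mono K α = ∏ i, X i ^ α i := by
  rw [mono, monomial_eq, map_one, one_mul, Finsupp.prod_fintype _ _ (by simp)]
  rfl

/-- If some monomial of `B` is supported in each `t`-element set of variables, then the
quotient by the ideal generated by `B` has dimension less than `t`. -/
lemma ringKrullDim_quotient_idealOf_le (K : Type*) [Field K] {n t : ℕ} (ht : 1 ≤ t)
    (B : Finset (Fin n → ℕ))
    (h : ∀ T : Finset (Fin n), T.card = t → ∃ α ∈ B, ∀ i ∉ T, α i = 0) :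
    ringKrullDim (MvPolynomial (Fin n) K ⧸ idealOf K B) ≤ ((t - 1 : ℕ) : WithBot ℕ∞) := by
  classical
  refine ringKrullDim_quotient_le_of_forall_prime _ _ fun P hP hI => ?_
  set T : Finset (Fin n) := {i | (X i : MvPolynomial (Fin n) K) ∉ P} with hT
  have hcard : T.card ≤ t - 1 := by
    by_contra! hlt
    obtain ⟨U, hUT, hU⟩ := Finset.exists_subset_card_eq (show t ≤ T.card by lia)
    obtain ⟨α, hα, hsupp⟩ := h U hU
    have hmem : mono K α ∈ P := hI (Ideal.subset_span ⟨α, hα, rfl⟩)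
    rw [mono_eq_prod, hP.prod_mem_iff] at hmem
    obtain ⟨i, -, hi⟩ := hmem
    by_cases hiU : i ∈ U
    · exact (Finset.mem_filter.mp (hUT hiU)).2 (hP.mem_of_pow_mem _ hi)
    · rw [hsupp i hiU, pow_zero] at hi
      exact hP.ne_top ((Ideal.eq_top_iff_one P).mpr hi)
  let f : MvPolynomial T K →ₐ[K] MvPolynomial (Fin n) K ⧸ P :=
    aeval fun i => Ideal.Quotient.mkₐ K P (X i.1)
  have hX : ∀ i, Ideal.Quotient.mkₐ K P (X i) ∈ f.range := by
    intro i
    by_cases hi : i ∈ T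
    · exact ⟨X ⟨i, hi⟩, by simp [f]⟩
    · have h0 : Ideal.Quotient.mkₐ K P (X i) = 0 := by
        rw [Ideal.Quotient.mkₐ_eq_mk, Ideal.Quotient.eq_zero_iff_mem]
        simpa [hT] using hi
      rw [h0]
      exact zero_mem _
  have hf : Function.Surjective f := by
    intro y
    obtain ⟨q, rfl⟩ := Ideal.Quotient.mkₐ_surjective K P y
    change Ideal.Quotient.mkₐ K P q ∈ f.range
    induction q using MvPolynomial.induction_on with
    | C a =>
      exact ⟨C a, (f.commutes a).trans ((Ideal.Quotient.mkₐ K P).commutes a).symm⟩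
    | add p q hp hq => rw [map_add]; exact add_mem hp hq
    | mul_X p i hp => rw [map_mul]; exact mul_mem hp (hX i)
  refine (ringKrullDim_le_of_surjective f.toRingHom hf).trans ?_
  rw [MvPolynomial.ringKrullDim_of_isNoetherianRing, ringKrullDim_eq_zero_of_field, zero_add]
  simpa using hcard

/-- If the quotient by the ideal generated by `B` has dimension less than `T.card`, then some
monomial of `B` is supported in `T`. -/
lemma exists_supported_of_ringKrullDim_le (K : Type*) [Field K] {n t : ℕ} (ht : 1 ≤ t)
    (B : Finset (Fin n → ℕ)) (T : Finset (Fin n)) (hT : T.card = t)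
    (h : ringKrullDim (MvPolynomial (Fin n) K ⧸ idealOf K B) ≤ ((t - 1 : ℕ) : WithBot ℕ∞)) :
    ∃ α ∈ B, ∀ i ∉ T, α i = 0 := by
  classical
  by_contra! hB
  let f : MvPolynomial (Fin n) K →ₐ[K] MvPolynomial T K :=
    aeval fun i => if hi : i ∈ T then X ⟨i, hi⟩ else 0
  have hf : Function.Surjective f := by
    intro q
    refine ⟨rename Subtype.val q, ?_⟩
    have : f.comp (rename Subtype.val) = AlgHom.id K (MvPolynomial T K) := by
      ext i
      simp [f]
    exact DFunLike.congr_fun this q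
  have hker : ∀ a ∈ idealOf K B, f.toRingHom a = 0 := by
    suffices idealOf K B ≤ RingHom.ker f.toRingHom from fun a ha => this ha
    refine Ideal.span_le.mpr ?_
    rintro _ ⟨α, hα, rfl⟩
    obtain ⟨i, hiT, hi⟩ := hB α hα
    change f (mono K α) = 0
    rw [mono_eq_prod, map_prod]
    exact Finset.prod_eq_zero (Finset.mem_univ i) (by simp [f, hiT, hi])
  have hdim := (ringKrullDim_le_of_surjective (Ideal.Quotient.lift _ f.toRingHom hker)
    (Ideal.Quotient.lift_surjective_of_surjective _ hker hf)).trans h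
  rw [MvPolynomial.ringKrullDim_of_isNoetherianRing, ringKrullDim_eq_zero_of_field,
    zero_add] at hdim
  have : t ≤ t - 1 := by simpa [hT] using hdim
  lia

section ERprob

variable {n D : ℕ} {p : ℝ}

lemma ERprob_mono (h0 : 0 ≤ p) (h1 : p ≤ 1) {E F : Set (Finset (Fin n → ℕ))}
    (h : ∀ B, B ⊆ monSet n D → B ∈ E → B ∈ F) : ERprob n D p E ≤ ERprob n D p F := by
  classical
  refine Finset.sum_le_sum_of_subset_of_nonneg ?_ fun B _ _ =>
    mul_nonneg (pow_nonneg h0 _) (pow_nonneg (by linarith) _)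
  intro B hB
  rw [Finset.mem_filter, Finset.mem_powerset] at hB ⊢
  exact ⟨hB.1, h B hB.1 hB.2⟩

lemma ERprob_nonneg (h0 : 0 ≤ p) (h1 : p ≤ 1) (E : Set (Finset (Fin n → ℕ))) :
    0 ≤ ERprob n D p E :=
  Finset.sum_nonneg fun _ _ => mul_nonneg (pow_nonneg h0 _) (pow_nonneg (by linarith) _)

lemma ERprob_add_compl (E : Set (Finset (Fin n → ℕ))) :
    ERprob n D p E + ERprob n D p Eᶜ = 1 := by
  classical
  have h := Finset.sum_pow_mul_eq_add_pow p (1 - p) (monSet n D)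
  rw [add_sub_cancel, one_pow, ← Finset.sum_filter_add_sum_filter_not _ (· ∈ E)] at h
  rw [← h]
  simp only [ERprob, Set.mem_compl_iff]

lemma ERprob_disjoint {A : Finset (Fin n → ℕ)} (hA : A ⊆ monSet n D) :
    ERprob n D p {B | Disjoint B A} = (1 - p) ^ A.card := by
  classical
  have h := Finset.sum_pow_mul_eq_add_pow p (1 - p) (monSet n D \ A)
  rw [add_sub_cancel, one_pow] at h
  have hset : (monSet n D).powerset.filter (· ∈ {B | Disjoint B A})
      = (monSet n D \ A).powerset := by
    ext B
    simp [Finset.subset_sdiff]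
  rw [← mul_one ((1 - p) ^ A.card)]
  nth_rw 2 [← h]
  rw [Finset.mul_sum, ERprob]
  refine Finset.sum_congr (by convert hset) fun B hB => ?_
  have h1 := Finset.card_le_card (Finset.mem_powerset.mp hB)
  have h2 := Finset.card_sdiff_add_card_eq_card hA
  rw [mul_left_comm, ← pow_add]
  congr 2
  lia

lemma ERprob_exists_le (h0 : 0 ≤ p) (h1 : p ≤ 1) {ι : Type*} (s : Finset ι)
    (E : ι → Set (Finset (Fin n → ℕ))) :
    ERprob n D p {B | ∃ i ∈ s, B ∈ E i} ≤ ∑ i ∈ s, ERprob n D p (E i) := by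
  classical
  simp only [ERprob, Finset.sum_filter]
  rw [Finset.sum_comm]
  refine Finset.sum_le_sum fun B _ => ?_
  have hw : 0 ≤ p ^ B.card * (1 - p) ^ ((monSet n D).card - B.card) :=
    mul_nonneg (pow_nonneg h0 _) (pow_nonneg (by linarith) _)
  have hnn : ∀ i ∈ s, 0 ≤ if B ∈ E i then
      p ^ B.card * (1 - p) ^ ((monSet n D).card - B.card) else 0 := fun i _ => by
    split_ifs
    exacts [hw, le_rfl]
  split_ifs with h
  · obtain ⟨i, hi, hBi⟩ := h
    exact (if_pos hBi).ge.trans (Finset.single_le_sum hnn hi)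
  · exact Finset.sum_nonneg hnn

end ERprob

/-- The exponent vectors in `monSet n D` supported in `T`. -/
def monSetSupp (n D : ℕ) (T : Finset (Fin n)) : Finset (Fin n → ℕ) :=
  (monSet n D).filter fun α => ∀ i ∉ T, α i = 0

lemma disjoint_monSetSupp_iff {n D : ℕ} {T : Finset (Fin n)} {B : Finset (Fin n → ℕ)}
    (hB : B ⊆ monSet n D) :
    Disjoint B (monSetSupp n D T) ↔ ¬ ∃ α ∈ B, ∀ i ∉ T, α i = 0 := by
  rw [Finset.disjoint_left]
  push Not
  refine forall₂_congr fun α hα => ?_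
  simp [monSetSupp, hB hα]

/-- The exponent vectors supported in `T` with all entries at most `c`. -/
def suppBox {n : ℕ} (T : Finset (Fin n)) (c : ℕ) : Finset (Fin n → ℕ) :=
  Fintype.piFinset fun i => if i ∈ T then Finset.range (c + 1) else {0}

lemma card_suppBox {n : ℕ} (T : Finset (Fin n)) (c : ℕ) :
    (suppBox T c).card = (c + 1) ^ T.card := by
  simp [suppBox, Fintype.card_piFinset, apply_ite Finset.card]

lemma mem_suppBox {n : ℕ} {T : Finset (Fin n)} {c : ℕ} {α : Fin n → ℕ} :
    α ∈ suppBox T c ↔ (∀ i ∈ T, α i ≤ c) ∧ ∀ i ∉ T, α i = 0 := by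
  simp only [suppBox, Fintype.mem_piFinset]
  constructor
  · intro h
    exact ⟨fun i hi => by simpa [hi, Nat.lt_succ_iff] using h i,
      fun i hi => by simpa [hi] using h i⟩
  · rintro ⟨h1, h2⟩ i
    by_cases hi : i ∈ T
    · simpa [hi, Nat.lt_succ_iff] using h1 i hi
    · simpa [hi] using h2 i hi

lemma card_monSetSupp_le (n D : ℕ) (T : Finset (Fin n)) :
    (monSetSupp n D T).card ≤ (D + 1) ^ T.card := by
  rw [← card_suppBox]
  refine Finset.card_le_card fun α hα => ?_
  simp only [monSetSupp, monSet, Finset.mem_filter, Fintype.mem_piFinset,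
    Finset.mem_range] at hα
  exact mem_suppBox.mpr ⟨fun i _ => Nat.lt_succ_iff.mp (hα.1.1 i), hα.2⟩

lemma le_card_monSetSupp_add_one (n D : ℕ) (T : Finset (Fin n)) :
    (D / T.card + 1) ^ T.card ≤ (monSetSupp n D T).card + 1 := by
  classical
  rw [← card_suppBox]
  refine le_trans (Finset.card_le_card fun α hα => ?_)
    (Finset.card_insert_le 0 (monSetSupp n D T))
  obtain ⟨h1, h2⟩ := mem_suppBox.mp hα
  rw [Finset.mem_insert, or_iff_not_imp_left]
  intro hne
  have hsum : ∑ i, α i ≤ D := by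
    rw [← Finset.sum_subset (Finset.subset_univ T) fun i _ hi => h2 i hi]
    refine (Finset.sum_le_card_nsmul T _ _ h1).trans ?_
    exact Nat.mul_div_le D T.card
  have hle : ∀ i, α i ≤ ∑ i, α i := fun i =>
    Finset.single_le_sum (fun _ _ => Nat.zero_le _) (Finset.mem_univ i)
  obtain ⟨j, hj⟩ := Function.ne_iff.mp hne
  simp only [monSetSupp, monSet, Finset.mem_filter, Fintype.mem_piFinset, Finset.mem_range]
  exact ⟨⟨fun i => Nat.lt_succ_iff.mpr ((hle i).trans hsum),
    lt_of_lt_of_le (Nat.pos_of_ne_zero hj) (hle j), hsum⟩, h2⟩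

lemma one_sub_pow_card_monSetSupp_le {n D t : ℕ} (ht : 1 ≤ t) {T : Finset (Fin n)}
    (hT : T.card = t) {p : ℝ} (h0 : 0 ≤ p) (h1 : p ≤ 1) :
    (1 - p) ^ (monSetSupp n D T).card ≤ Real.exp (1 - (D : ℝ) ^ t * p / (t : ℝ) ^ t) := by
  have ht0 : (0 : ℝ) < t := by exact_mod_cast ht
  have hdiv : (D : ℝ) / t ≤ (D / t : ℕ) + 1 := (Nat.lt_floor_add_one _).le.trans_eq (by
    rw [Nat.floor_div_eq_div])
  have hcard : ((D : ℝ) / t) ^ t ≤ (monSetSupp n D T).card + 1 := by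
    refine (pow_le_pow_left₀ (by positivity) hdiv t).trans ?_
    have := le_card_monSetSupp_add_one n D T
    rw [hT] at this
    exact_mod_cast this
  calc (1 - p) ^ (monSetSupp n D T).card
      ≤ Real.exp (-p) ^ (monSetSupp n D T).card :=
        pow_le_pow_left₀ (by linarith) (Real.one_sub_le_exp_neg p) _
    _ = Real.exp ((monSetSupp n D T).card * -p) := (Real.exp_nat_mul _ _).symm
    _ ≤ Real.exp (1 - (D : ℝ) ^ t * p / (t : ℝ) ^ t) := by
        rw [Real.exp_le_exp]
        have h := mul_le_mul_of_nonneg_right hcard h0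
        rw [div_pow, div_mul_eq_mul_div] at h
        linarith

/-- Theorem 3.4. For fixed `n` and `1 ≤ t ≤ n`, `D^{-t}` is a threshold
function for the property `dim S/𝔍 ≤ t-1`: if `D^t p(D) → 0` then
`P(dim S/𝔍 ≤ t-1) → 0`, and if `D^t p(D) → ∞` then `P(dim S/𝔍 ≤ t-1) → 1`. -/
theorem stmt8 (K : Type*) [Field K] (n t : ℕ) (hn : 1 ≤ n) (ht1 : 1 ≤ t) (ht2 : t ≤ n)
    (p : ℕ → ℝ) (hp : ∀ D, 0 < p D ∧ p D < 1) :
    (Filter.Tendsto (fun D : ℕ => (D : ℝ) ^ t * p D) Filter.atTop (nhds 0) →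
      Filter.Tendsto (fun D : ℕ => ERprob n D (p D)
          {B | ringKrullDim (MvPolynomial (Fin n) K ⧸ idealOf K B)
            ≤ ((t - 1 : ℕ) : WithBot (WithTop ℕ))})
        Filter.atTop (nhds 0)) ∧
    (Filter.Tendsto (fun D : ℕ => (D : ℝ) ^ t * p D) Filter.atTop Filter.atTop →
      Filter.Tendsto (fun D : ℕ => ERprob n D (p D)
          {B | ringKrullDim (MvPolynomial (Fin n) K ⧸ idealOf K B)
            ≤ ((t - 1 : ℕ) : WithBot (WithTop ℕ))})
        Filter.atTop (nhds 1)) := by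
  classical
  have h0 := fun D => (hp D).1.le
  have h1 := fun D => (hp D).2.le
  refine ⟨fun h => ?_, fun h => ?_⟩
  · obtain ⟨T, -, hT⟩ := Finset.exists_subset_card_eq
      (show t ≤ (Finset.univ : Finset (Fin n)).card by simpa using ht2)
    have hlim : Tendsto (fun D : ℕ => (2 : ℝ) ^ t * ((D : ℝ) ^ t * p D)) atTop (nhds 0) := by
      simpa using h.const_mul ((2 : ℝ) ^ t)
    refine tendsto_of_tendsto_of_tendsto_of_le_of_le' tendsto_const_nhds hlim
      (Eventually.of_forall fun D => ERprob_nonneg (h0 D) (h1 D) _) ?_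
    filter_upwards [eventually_ge_atTop 1] with D hD
    have hsub : monSetSupp n D T ⊆ monSet n D := Finset.filter_subset _ _
    have hmono : ERprob n D (p D) _ ≤
        ERprob n D (p D) {B | Disjoint B (monSetSupp n D T)}ᶜ :=
      ERprob_mono (h0 D) (h1 D) fun B hB hE => by
        rw [Set.mem_compl_iff, Set.mem_ofPred_eq, disjoint_monSetSupp_iff hB, not_not]
        exact exists_supported_of_ringKrullDim_le K ht1 B T hT hE
    refine hmono.trans ?_
    have hadd := ERprob_add_compl (n := n) (D := D) (p := p D)
      {B | Disjoint B (monSetSupp n D T)}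
    rw [ERprob_disjoint hsub] at hadd
    have hbern := one_add_mul_le_pow (a := -p D) (by linarith [h1 D]) (monSetSupp n D T).card
    rw [← sub_eq_add_neg] at hbern
    have hcard : ((monSetSupp n D T).card : ℝ) ≤ 2 ^ t * (D : ℝ) ^ t := by
      have h := card_monSetSupp_le n D T
      rw [hT] at h
      rw [← mul_pow]
      exact_mod_cast h.trans (Nat.pow_le_pow_left (by lia) t)
    have := mul_le_mul_of_nonneg_right hcard (h0 D)
    linarith
  · let E := {B : Finset (Fin n → ℕ) | ringKrullDim (MvPolynomial (Fin n) K ⧸ idealOf K B)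
            ≤ ((t - 1 : ℕ) : WithBot (WithTop ℕ))}
    set S := Finset.powersetCard t (Finset.univ : Finset (Fin n))
    have hbound : ∀ D, ERprob n D (p D) Eᶜ ≤
        S.card * Real.exp (1 - (D : ℝ) ^ t * p D / (t : ℝ) ^ t) := by
      intro D
      calc ERprob n D (p D) Eᶜ
          ≤ ERprob n D (p D) {B | ∃ T ∈ S, B ∈ {B | Disjoint B (monSetSupp n D T)}} := by
            refine ERprob_mono (h0 D) (h1 D) fun B hB hBE => ?_
            by_contra hcon
            refine hBE (ringKrullDim_quotient_idealOf_le K ht1 B fun T hT => ?_)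
            by_contra hno
            exact hcon ⟨T, by simp [S, hT], (disjoint_monSetSupp_iff hB).mpr hno⟩
        _ ≤ ∑ T ∈ S, ERprob n D (p D) {B | Disjoint B (monSetSupp n D T)} :=
            ERprob_exists_le (h0 D) (h1 D) _ _
        _ ≤ ∑ T ∈ S, Real.exp (1 - (D : ℝ) ^ t * p D / (t : ℝ) ^ t) := by
            refine Finset.sum_le_sum fun T hT => ?_
            rw [ERprob_disjoint (show monSetSupp n D T ⊆ _ from Finset.filter_subset _ _)]
            exact one_sub_pow_card_monSetSupp_le ht1 (Finset.mem_powersetCard.mp hT).2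
              (h0 D) (h1 D)
        _ = _ := by rw [Finset.sum_const, nsmul_eq_mul]
    have hlim : Tendsto (fun D : ℕ => (S.card : ℝ) *
        Real.exp (1 - (D : ℝ) ^ t * p D / (t : ℝ) ^ t)) atTop (nhds 0) := by
      have ht0 : (0 : ℝ) < (t : ℝ) ^ t := by positivity
      have h2 : Tendsto (fun D : ℕ => 1 - (D : ℝ) ^ t * p D / (t : ℝ) ^ t) atTop atBot := by
        simpa [sub_eq_add_neg] using
          tendsto_atBot_add_const_left _ 1 (tendsto_neg_atTop_atBot.comp (h.atTop_div_const ht0))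
      simpa using (Real.tendsto_exp_atBot.comp h2).const_mul (S.card : ℝ)
    have hcompl : Tendsto (fun D => ERprob n D (p D) Eᶜ) atTop (nhds 0) :=
      squeeze_zero (fun D => ERprob_nonneg (h0 D) (h1 D) _) hbound hlim
    have heq : (fun D => ERprob n D (p D) E) = fun D => 1 - ERprob n D (p D) Eᶜ :=
      funext fun D => eq_sub_of_add_eq (ERprob_add_compl E)
    rw [heq]
    simpa using hcompl.const_sub 1

end
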